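/- With the q-quadratic lattice and the operators D_x, S_x as in the context, for all complex polynomials f and g the following polynomial identities hold: (i) D_x(fg) = (D_x f)·(S_x g) + (S_x f)·(D_x g); and (ii) S_x(fg) = U₂·(D_x f)·(D_x g) + (S_x f)·(S_x g), where U₂(z) = (α²−1)((z−𝔠₃)² − 4𝔠₁𝔠₂). -/

import Mathlib

open Polynomial

noncomputable def qp (q : ℝ) (t : ℂ) : ℂ := Complex.exp (t * (Real.log q : ℂ))

noncomputable def alphaL (q : ℝ) : ℂ := (qp q (1/2) + qp q (-(1/2))) / 2

noncomputable def alphaN (q : ℝ) (n : ℕ) : ℂ :=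
  (qp q ((n : ℂ) / 2) + qp q (-((n : ℂ) / 2))) / 2

noncomputable def gammaN (q : ℝ) (n : ℕ) : ℂ :=
  (qp q ((n : ℂ) / 2) - qp q (-((n : ℂ) / 2))) / (qp q (1/2) - qp q (-(1/2)))

noncomputable def latX (q : ℝ) (c1 c2 c3 s : ℂ) : ℂ := c1 * qp q (-s) + c2 * qp q s + c3

noncomputable def U1L (q : ℝ) (c3 : ℂ) : Polynomial ℂ :=
  Polynomial.C (alphaL q ^ 2 - 1) * (Polynomial.X - Polynomial.C c3)

noncomputable def U2L (q : ℝ) (c1 c2 c3 : ℂ) : Polynomial ℂ :=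
  Polynomial.C (alphaL q ^ 2 - 1) *
    ((Polynomial.X - Polynomial.C c3) ^ 2 - Polynomial.C (4 * c1 * c2))

theorem qp_add (q : ℝ) (s t : ℂ) : qp q (s + t) = qp q s * qp q t := by
  simp only [qp, add_mul, Complex.exp_add]

theorem qp_mul_qp_neg (q : ℝ) (t : ℂ) : qp q t * qp q (-t) = 1 := by
  rw [← qp_add]
  simp [qp]

theorem exists_qp_eq {q : ℝ} (hq : 0 < q) (hq1 : q ≠ 1) {u : ℂ} (hu : u ≠ 0) :
    ∃ s, qp q s = u := by
  have h : (Real.log q : ℂ) ≠ 0 :=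
    Complex.ofReal_ne_zero.2 (Real.log_ne_zero_of_pos_of_ne_one hq hq1)
  exact ⟨Complex.log u / Real.log q, by rw [qp, div_mul_cancel₀ _ h, Complex.exp_log hu]⟩

theorem four_mul_alphaL_sq_sub_one (q : ℝ) :
    4 * (alphaL q ^ 2 - 1) = (qp q (1/2) - qp q (-(1/2))) ^ 2 := by
  have h := qp_mul_qp_neg q (1/2)
  rw [alphaL]
  linear_combination 4 * h

theorem alphaL_sq_sub_one_ne_zero {q : ℝ} (hq : 0 < q) (hq1 : q ≠ 1) :
    alphaL q ^ 2 - 1 ≠ 0 := by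
  intro h
  have h2 : qp q (1/2) - qp q (-(1/2)) = 0 := by
    apply pow_eq_zero_iff two_ne_zero |>.1
    rw [← four_mul_alphaL_sq_sub_one, h, mul_zero]
  have h3 : Real.exp (1/2 * Real.log q) = Real.exp (-(1/2) * Real.log q) := by
    have := sub_eq_zero.1 h2
    simp only [qp] at this
    apply Complex.ofReal_injective
    push_cast
    exact this
  have h4 := Real.exp_injective h3
  exact Real.log_ne_zero_of_pos_of_ne_one hq hq1 (by linarith)

theorem U2L_ne_zero {q : ℝ} (hq : 0 < q) (hq1 : q ≠ 1) {c1 c2 : ℂ} (c3 : ℂ)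
    (hc : c1 * c2 ≠ 0) : U2L q c1 c2 c3 ≠ 0 := by
  intro h
  have h0 := congrArg (Polynomial.eval c3) h
  have := alphaL_sq_sub_one_ne_zero hq hq1
  simp [U2L, this, mul_assoc, hc] at h0

theorem latX_surjective {q : ℝ} (hq : 0 < q) (hq1 : q ≠ 1) {c1 c2 : ℂ} (c3 : ℂ)
    (hc : c1 * c2 ≠ 0) : Function.Surjective (latX q c1 c2 c3) := by
  intro z
  obtain ⟨hc1, hc2⟩ := mul_ne_zero_iff.1 hc
  obtain ⟨d, hd⟩ := IsAlgClosed.exists_eq_mul_self (discrim c2 (c3 - z) c1)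
  obtain ⟨u, hu⟩ := exists_quadratic_eq_zero hc2 ⟨d, hd⟩
  have hu0 : u ≠ 0 := by
    rintro rfl
    simp [hc1] at hu
  obtain ⟨s, rfl⟩ := exists_qp_eq hq hq1 hu0
  refine ⟨s, ?_⟩
  have h := qp_mul_qp_neg q s
  rw [latX]
  linear_combination qp q (-s) * hu - (c2 * qp q s + c3 - z) * h

theorem latX_sub_sq (q : ℝ) (c1 c2 c3 s : ℂ) :
    (latX q c1 c2 c3 (s + 1/2) - latX q c1 c2 c3 (s - 1/2)) ^ 2 =
      4 * (U2L q c1 c2 c3).eval (latX q c1 c2 c3 s) := by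
  have h := qp_mul_qp_neg q s
  have hΔ : latX q c1 c2 c3 (s + 1/2) - latX q c1 c2 c3 (s - 1/2) =
      (qp q (1/2) - qp q (-(1/2))) * (c2 * qp q s - c1 * qp q (-s)) := by
    simp only [latX, sub_eq_add_neg, neg_add, neg_neg, qp_add]
    ring
  rw [hΔ, mul_pow, ← four_mul_alphaL_sq_sub_one]
  simp only [U2L, latX, eval_mul, eval_C, eval_sub, eval_pow, eval_X]
  linear_combination (-16 * c1 * c2 * (alphaL q ^ 2 - 1)) * h

theorem eq_of_eval_latX_eq {q : ℝ} (hq : 0 < q) (hq1 : q ≠ 1) {c1 c2 c3 : ℂ}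
    (hc : c1 * c2 ≠ 0) {P Q : Polynomial ℂ}
    (h : ∀ s, latX q c1 c2 c3 (s + 1/2) ≠ latX q c1 c2 c3 (s - 1/2) →
      P.eval (latX q c1 c2 c3 s) = Q.eval (latX q c1 c2 c3 s)) : P = Q := by
  apply mul_left_cancel₀ (U2L_ne_zero hq hq1 c3 hc)
  apply Polynomial.funext
  intro z
  obtain ⟨s, rfl⟩ := latX_surjective hq hq1 c3 hc z
  rw [eval_mul, eval_mul]
  by_cases hs : latX q c1 c2 c3 (s + 1/2) = latX q c1 c2 c3 (s - 1/2)
  · have h0 := latX_sub_sq q c1 c2 c3 s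
    rw [hs, sub_self, zero_pow two_ne_zero] at h0
    rw [(mul_eq_zero.1 h0.symm).resolve_left (by norm_num), zero_mul, zero_mul]
  · rw [h s hs]

theorem stmt_3 (q : ℝ) (hq : 0 < q) (hq1 : q ≠ 1) (c1 c2 c3 : ℂ) (hc : c1 * c2 ≠ 0)
    (Dx Sx : Polynomial ℂ → Polynomial ℂ)
    (hDx : ∀ (f : Polynomial ℂ) (s : ℂ),
      latX q c1 c2 c3 (s + 1/2) ≠ latX q c1 c2 c3 (s - 1/2) →
      (Dx f).eval (latX q c1 c2 c3 s) =
        (f.eval (latX q c1 c2 c3 (s + 1/2)) - f.eval (latX q c1 c2 c3 (s - 1/2))) /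
          (latX q c1 c2 c3 (s + 1/2) - latX q c1 c2 c3 (s - 1/2)))
    (hSx : ∀ (f : Polynomial ℂ) (s : ℂ),
      (Sx f).eval (latX q c1 c2 c3 s) =
        (f.eval (latX q c1 c2 c3 (s + 1/2)) + f.eval (latX q c1 c2 c3 (s - 1/2))) / 2)
    :
    ∀ f g : Polynomial ℂ,
      Dx (f * g) = Dx f * Sx g + Sx f * Dx g ∧
      Sx (f * g) = U2L q c1 c2 c3 * Dx f * Dx g + Sx f * Sx g := by
  intro f g
  constructor <;> refine eq_of_eval_latX_eq (c3 := c3) hq hq1 hc fun s hs => ?_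
  · have hs' := sub_ne_zero.2 hs
    simp only [eval_mul, eval_add, hDx _ s hs, hSx]
    field_simp
    ring
  · have hs' := sub_ne_zero.2 hs
    have hU : (U2L q c1 c2 c3).eval (latX q c1 c2 c3 s) =
        (latX q c1 c2 c3 (s + 1/2) - latX q c1 c2 c3 (s - 1/2)) ^ 2 / 4 := by
      rw [latX_sub_sq]
      ring
    simp only [eval_mul, eval_add, hDx _ s hs, hSx, hU]
    generalize latX q c1 c2 c3 (s + 1/2) = a at hs' ⊢
    generalize latX q c1 c2 c3 (s - 1/2) = b at hs' ⊢
    field_simp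
    ring
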